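/- Let G be a finite simple connected regular graph in which every vertex is pseudo-distance-regular. Then G is distance-regular. -/

import Mathlib

open Polynomial Matrix

/-- The distance-`i` matrix of a graph: `(A_i)_{u,v} = 1` if `d(u,v) = i` and `0` otherwise. -/
noncomputable def distMatrix {V : Type*} [Fintype V] (G : SimpleGraph V) (i : ℕ) :
    Matrix V V ℝ :=
  Matrix.of fun u v => if G.dist u v = i then 1 else 0

/-- `G` has diameter `d`. -/
def IsDiam {V : Type*} (G : SimpleGraph V) (d : ℕ) : Prop :=
  (∀ u v, G.dist u v ≤ d) ∧ ∃ u v, G.dist u v = d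

/-- `u` has eccentricity `e` in `G`. -/
def IsEcc {V : Type*} (G : SimpleGraph V) (u : V) (e : ℕ) : Prop :=
  (∀ v, G.dist u v ≤ e) ∧ ∃ v, G.dist u v = e

/-- The eigenvalue support of the vertex `u`. -/
def eSupport {V : Type*} [Fintype V] (A : Matrix V V ℝ) (u : V) : Set ℝ :=
  {θ : ℝ | ∃ w : V → ℝ, A *ᵥ w = θ • w ∧ w u ≠ 0}

/-- The vertex `u`, of eccentricity `e`, is pseudo-distance-regular. -/
def IsPseudoDistRegular {V : Type*} [Fintype V] [DecidableEq V] (G : SimpleGraph V)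
    (A : Matrix V V ℝ) (u : V) (e : ℕ) : Prop :=
  (eSupport A u).ncard = e + 1 ∧
    ∀ i ≤ e, ∃ p : Polynomial ℝ, p.degree = (i : WithBot ℕ) ∧
      ∀ w, (aeval A p *ᵥ Pi.single u 1) w ≠ 0 ↔ G.dist u w = i

/-- `G`, of diameter `d` and with adjacency matrix `A`, is distance-regular. -/
def IsDistRegular {V : Type*} [Fintype V] [DecidableEq V] (G : SimpleGraph V)
    (A : Matrix V V ℝ) (d : ℕ) : Prop :=
  (spectrum ℝ A).ncard = d + 1 ∧
    ∀ i ≤ d, ∃ p : Polynomial ℝ, p.degree = (i : WithBot ℕ) ∧ aeval A p = distMatrix G i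

theorem Matrix.IsSymm.aeval {V : Type*} [Fintype V] [DecidableEq V]
    {A : Matrix V V ℝ} (hA : A.IsSymm) (f : ℝ[X]) :
    (Polynomial.aeval A f).IsSymm := by
  induction f using Polynomial.induction_on' with
  | add p q hp hq => simpa using hp.add hq
  | monomial n a =>
    rw [Polynomial.aeval_monomial, ← Algebra.smul_def]
    exact (hA.pow n).smul a

theorem aeval_mulVec_of_mulVec_eq_smul {V : Type*} [Fintype V] [DecidableEq V]
    {A : Matrix V V ℝ} {x : V → ℝ} {θ : ℝ}
    (hx : A *ᵥ x = θ • x) (f : ℝ[X]) : aeval A f *ᵥ x = f.eval θ • x := by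
  induction f using Polynomial.induction_on' with
  | add p q hp hq => simp [Matrix.add_mulVec, hp, hq, add_smul]
  | monomial n a =>
    rw [Polynomial.aeval_monomial, ← Algebra.smul_def, Matrix.smul_mulVec, Polynomial.eval_monomial,
      mul_smul]
    congr 1
    induction n with
    | zero => simp
    | succ n ih => rw [pow_succ, ← Matrix.mulVec_mulVec, hx, Matrix.mulVec_smul, ih, smul_smul,
        pow_succ, mul_comm]

theorem aeval_mulVec_single_eq_zero {V : Type*} [Fintype V] [DecidableEq V]
    {A : Matrix V V ℝ} (hA : A.IsHermitian) {u : V} {f : ℝ[X]}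
    (hf : ∀ θ ∈ eSupport A u, f.eval θ = 0) : aeval A f *ᵥ Pi.single u 1 = 0 := by
  have key : (Pi.single u 1 : V → ℝ) = ∑ j, (hA.eigenvectorBasis j).ofLp u •
      (hA.eigenvectorBasis j).ofLp := by
    have h := hA.eigenvectorBasis.sum_repr' (EuclideanSpace.single u (1 : ℝ))
    have h2 := congrArg WithLp.ofLp h
    simp only [EuclideanSpace.inner_single_right, WithLp.ofLp_sum, WithLp.ofLp_smul] at h2
    simpa using h2.symm
  rw [key, Matrix.mulVec_sum]
  refine Finset.sum_eq_zero fun j _ => ?_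
  have hj := hA.mulVec_eigenvectorBasis j
  rw [Matrix.mulVec_smul, aeval_mulVec_of_mulVec_eq_smul hj]
  by_cases h0 : (hA.eigenvectorBasis j).ofLp u = 0
  · simp [h0]
  · rw [hf _ ⟨_, hj, h0⟩]
    simp

theorem exists_eq_sum_C_mul_of_degree_lt {q : ℕ → ℝ[X]} {n : ℕ}
    (hq : ∀ i < n, (q i).degree = (i : WithBot ℕ)) {f : ℝ[X]} (hf : f.degree < n) :
    ∃ c : ℕ → ℝ, f = ∑ i ∈ Finset.range n, C (c i) * q i := by
  induction n generalizing f with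
  | zero =>
    refine ⟨0, ?_⟩
    simpa [Nat.WithBot.lt_zero_iff] using hf
  | succ n ih =>
    have hqn := hq n n.lt_succ_self
    have hlead : (q n).coeff n ≠ 0 := Polynomial.coeff_ne_zero_of_eq_degree hqn
    have hlow : (f - C (f.coeff n / (q n).coeff n) * q n).degree < n := by
      rw [Polynomial.degree_lt_iff_coeff_zero]
      intro m hm
      rcases hm.eq_or_lt with rfl | hm
      · simp [hlead]
      · have hq0 : (q n).coeff m = 0 :=
          Polynomial.coeff_eq_zero_of_degree_lt (by rw [hqn]; exact Nat.cast_lt.2 hm)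
        have hf0 : f.coeff m = 0 :=
          Polynomial.coeff_eq_zero_of_degree_lt (hf.trans_le (Nat.cast_le.2 hm))
        simp [hq0, hf0]
    obtain ⟨c, hc⟩ := ih (fun i hi => hq i (hi.trans n.lt_succ_self)) hlow
    refine ⟨fun i => if i = n then f.coeff n / (q n).coeff n else c i, ?_⟩
    rw [Finset.sum_range_succ, ← sub_eq_iff_eq_add]
    simp only [if_true]
    rw [hc]
    refine Finset.sum_congr rfl fun i hi => ?_
    rw [if_neg (Finset.mem_range.1 hi).ne]

theorem SimpleGraph.Connected.exists_dist_eq {V : Type*} {G : SimpleGraph V} (hG : G.Connected)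
    {u v : V} {i : ℕ} (hi : i ≤ G.dist u v) : ∃ w, G.dist u w = i := by
  obtain ⟨p, hp⟩ := hG.exists_walk_length_eq_dist u v
  refine ⟨p.getVert i, le_antisymm ?_ ?_⟩
  · exact (SimpleGraph.dist_le (p.take i)).trans (by simp)
  · have h1 := SimpleGraph.dist_le (p.drop i)
    have h2 := hG.dist_triangle (u := u) (v := p.getVert i) (w := v)
    have h3 : (p.drop i).length = p.length - i := by simp
    omega

theorem exists_isEcc {V : Type*} [Fintype V] {G : SimpleGraph V} (u : V) :
    ∃ e, IsEcc G u e := by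
  obtain ⟨v, -, hv⟩ := Finset.exists_max_image Finset.univ (G.dist u) ⟨u, Finset.mem_univ u⟩
  exact ⟨G.dist u v, fun w => hv w (Finset.mem_univ w), v, rfl⟩

theorem aeval_mul_apply {V : Type*} [Fintype V] [DecidableEq V] {A : Matrix V V ℝ}
    (hA : A.IsSymm) (f g : ℝ[X]) (u : V) :
    aeval A (f * g) u u = ∑ w, aeval A f w u * aeval A g w u := by
  rw [map_mul, Matrix.mul_apply]
  exact Finset.sum_congr rfl fun w _ => by rw [(hA.aeval f).apply]

/-- The polynomials `q 0, …, q e` have degrees `0, …, e`, and `q i` maps `e_u` to the indicator of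
the vertices at distance `i` from `u`. -/
def IsDistancePolynomials {V : Type*} [Fintype V] [DecidableEq V] (G : SimpleGraph V)
    (A : Matrix V V ℝ) (u : V) (e : ℕ) (q : ℕ → ℝ[X]) : Prop :=
  ∀ i ≤ e, (q i).degree = (i : WithBot ℕ) ∧
    ∀ w, aeval A (q i) w u = if G.dist u w = i then 1 else 0

theorem IsDistancePolynomials.exists_expansion {V : Type*} [Fintype V] [DecidableEq V]
    {G : SimpleGraph V} {A : Matrix V V ℝ} {u : V} {e : ℕ} {q : ℕ → ℝ[X]}
    (hq : IsDistancePolynomials G A u e q) {n : ℕ} (hn : n ≤ e + 1) {f : ℝ[X]}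
    (hf : f.degree < n) :
    ∃ c : ℕ → ℝ, f = ∑ i ∈ Finset.range n, C (c i) * q i ∧
      ∀ w, aeval A f w u = if G.dist u w < n then c (G.dist u w) else 0 := by
  obtain ⟨c, hc⟩ := exists_eq_sum_C_mul_of_degree_lt (fun i hi => (hq i (by omega)).1) hf
  refine ⟨c, hc, fun w => ?_⟩
  rw [hc, map_sum, Matrix.sum_apply]
  have : ∀ i ∈ Finset.range n, aeval A (C (c i) * q i) w u =
      if G.dist u w = i then c i else 0 := by
    intro i hi
    have hi := Finset.mem_range.1 hi
    rw [← Polynomial.smul_eq_C_mul, map_smul, Matrix.smul_apply, (hq i (by omega)).2 w]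
    simp
  rw [Finset.sum_congr rfl this, Finset.sum_ite_eq]
  simp

theorem exists_monic_annihilator {V : Type*} [Fintype V] [DecidableEq V] {A : Matrix V V ℝ}
    (hA : A.IsHermitian) {u : V} {e : ℕ} (hS : (eSupport A u).ncard = e + 1) :
    ∃ M : ℝ[X], M.Monic ∧ M.Separable ∧ M.degree = ((e + 1 : ℕ) : WithBot ℕ) ∧
      (∀ θ, M.eval θ = 0 ↔ θ ∈ eSupport A u) ∧ ∀ w, aeval A M w u = 0 := by
  have hfin : (eSupport A u).Finite := Set.finite_of_ncard_pos (by omega)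
  have heval : ∀ θ, (∏ t ∈ hfin.toFinset, (X - C t)).eval θ = 0 ↔ θ ∈ eSupport A u := by
    intro θ
    simp [Polynomial.eval_prod, Finset.prod_eq_zero_iff, sub_eq_zero]
  refine ⟨∏ t ∈ hfin.toFinset, (X - C t), Polynomial.monic_prod_X_sub_C _ _,
    Polynomial.separable_prod_X_sub_C_iff'.2 fun _ _ _ _ h => h, ?_, heval, ?_⟩
  · rw [Polynomial.degree_prod_of_monic _ _ fun t _ => Polynomial.monic_X_sub_C t]
    simp [← Set.ncard_eq_toFinset_card _ hfin, hS]
  · intro w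
    have h := aeval_mulVec_single_eq_zero hA fun θ hθ => (heval θ).2 hθ
    rw [Matrix.mulVec_single_one] at h
    exact congrFun h w

theorem adjMatrix_mulVec_one {V : Type*} [Fintype V] {G : SimpleGraph V} [DecidableRel G.Adj]
    {k : ℕ} (hreg : ∀ v, G.degree v = k) :
    G.adjMatrix ℝ *ᵥ (fun _ => (1 : ℝ)) = (k : ℝ) • fun _ => (1 : ℝ) := by
  ext v
  simp [SimpleGraph.adjMatrix_mulVec_apply, hreg]

theorem sum_aeval_adjMatrix {V : Type*} [Fintype V] [DecidableEq V] {G : SimpleGraph V}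
    [DecidableRel G.Adj] {k : ℕ} (hreg : ∀ v, G.degree v = k) (f : ℝ[X]) (u : V) :
    ∑ w, aeval (G.adjMatrix ℝ) f w u = f.eval (k : ℝ) := by
  have h := congrFun (aeval_mulVec_of_mulVec_eq_smul (adjMatrix_mulVec_one hreg) f) u
  simp only [Matrix.mulVec, dotProduct, mul_one, Pi.smul_apply, smul_eq_mul] at h
  rw [← h]
  exact Finset.sum_congr rfl fun w _ => (G.isSymm_adjMatrix.aeval f).apply u w

theorem exists_aeval_adjMatrix_eq_one {V : Type*} [Fintype V] [DecidableEq V]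
    {G : SimpleGraph V} [DecidableRel G.Adj] (hconn : G.Connected) {k : ℕ}
    (hreg : ∀ v, G.degree v = k) {u : V} {e : ℕ}
    (hS : (eSupport (G.adjMatrix ℝ) u).ncard = e + 1) :
    ∃ f : ℝ[X], f.degree < ((e + 1 : ℕ) : WithBot ℕ) ∧
      ∀ w, aeval (G.adjMatrix ℝ) f w u = 1 := by
  obtain ⟨M, -, hsep, hdeg, hroot, hann⟩ := exists_monic_annihilator (G.isHermitian_adjMatrix ℝ) hS
  obtain ⟨g, rfl⟩ : (X - C (k : ℝ)) ∣ M := Polynomial.dvd_iff_isRoot.2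
    ((hroot k).2 ⟨fun _ => 1, adjMatrix_mulVec_one hreg, one_ne_zero⟩)
  have hgk : g.eval (k : ℝ) ≠ 0 := by
    intro h0
    obtain ⟨r, rfl⟩ := Polynomial.dvd_iff_isRoot.2 h0
    exact Polynomial.not_isUnit_X_sub_C (k : ℝ) (hsep.squarefree _ ⟨r, by ring⟩)
  have hgdeg : g.degree < ((e + 1 : ℕ) : WithBot ℕ) := by
    have hg0 : g ≠ 0 := by rintro rfl; simp at hgk
    rw [Polynomial.degree_mul, Polynomial.degree_X_sub_C, Polynomial.degree_eq_natDegree hg0] at hdeg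
    rw [Polynomial.degree_eq_natDegree hg0]
    norm_cast at hdeg ⊢
    omega
  have hlap : G.lapMatrix ℝ *ᵥ (aeval (G.adjMatrix ℝ) g).col u = 0 := by
    ext v
    have h := hann v
    rw [map_mul, map_sub, aeval_X, aeval_C, sub_mul, Matrix.sub_apply,
      SimpleGraph.adjMatrix_mul_apply, ← Algebra.smul_def, Matrix.smul_apply, smul_eq_mul] at h
    rw [SimpleGraph.lapMatrix_mulVec_apply, hreg]
    simp only [Matrix.col_apply, Pi.zero_apply]
    linarith
  have hconst : ∀ w, aeval (G.adjMatrix ℝ) g w u = aeval (G.adjMatrix ℝ) g u u := fun w =>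
    G.lapMatrix_mulVec_eq_zero_iff_forall_reachable.1 hlap w u (hconn.preconnected w u)
  have hsum := sum_aeval_adjMatrix hreg g u
  rw [Finset.sum_congr rfl fun w _ => hconst w] at hsum
  have hu : aeval (G.adjMatrix ℝ) g u u ≠ 0 := by
    intro h0
    apply hgk
    rw [← hsum]
    simp [h0]
  refine ⟨C (aeval (G.adjMatrix ℝ) g u u)⁻¹ * g, ?_, fun w => ?_⟩
  · rwa [Polynomial.degree_C_mul (inv_ne_zero hu)]
  · rw [← Polynomial.smul_eq_C_mul, map_smul, Matrix.smul_apply, smul_eq_mul, hconst w,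
      inv_mul_cancel₀ hu]

theorem exists_isDistancePolynomials {V : Type*} [Fintype V] [DecidableEq V]
    {G : SimpleGraph V} [DecidableRel G.Adj] (hconn : G.Connected) {k : ℕ}
    (hreg : ∀ v, G.degree v = k) {u : V} {e : ℕ} (he : IsEcc G u e)
    (h : IsPseudoDistRegular G (G.adjMatrix ℝ) u e) :
    ∃ q, IsDistancePolynomials G (G.adjMatrix ℝ) u e q := by
  obtain ⟨f, hfdeg, hf⟩ := exists_aeval_adjMatrix_eq_one hconn hreg h.1
  choose! p hpdeg hp using h.2
  simp only [Matrix.mulVec_single_one, Matrix.col_apply] at hp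
  obtain ⟨c, hc⟩ := exists_eq_sum_C_mul_of_degree_lt (fun i hi => hpdeg i (by omega)) hfdeg
  have hone : ∀ w, c (G.dist u w) * aeval (G.adjMatrix ℝ) (p (G.dist u w)) w u = 1 := by
    intro w
    rw [← hf w, hc, map_sum, Matrix.sum_apply, Finset.sum_eq_single (G.dist u w)]
    · rw [← Polynomial.smul_eq_C_mul, map_smul, Matrix.smul_apply, smul_eq_mul]
    · intro i hi hne
      rw [← Polynomial.smul_eq_C_mul, map_smul, Matrix.smul_apply, smul_eq_mul,
        not_not.1 (mt (hp i (by simpa [Nat.lt_succ_iff] using hi) w).1 hne.symm), mul_zero]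
    · intro hn
      exact absurd (Finset.mem_range.2 (Nat.lt_succ_of_le (he.1 w))) hn
  refine ⟨fun i => C (c i) * p i, fun i hi => ?_⟩
  obtain ⟨v, hv⟩ := he.2
  obtain ⟨w, rfl⟩ := hconn.exists_dist_eq (hi.trans_eq hv.symm)
  refine ⟨?_, fun x => ?_⟩
  · rw [Polynomial.degree_C_mul (left_ne_zero_of_mul_eq_one (hone w)), hpdeg _ hi]
  · beta_reduce
    rw [← Polynomial.smul_eq_C_mul, map_smul, Matrix.smul_apply, smul_eq_mul]
    split_ifs with hx
    · rw [← hx, hone x]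
    · rw [not_not.1 (mt (hp _ hi x).1 hx), mul_zero]

theorem aeval_adjMatrix_apply_self_eq {V : Type*} [Fintype V] [DecidableEq V]
    {G : SimpleGraph V} [DecidableRel G.Adj] (hconn : G.Connected) {k : ℕ}
    (hreg : ∀ v, G.degree v = k)
    (hcol : ∀ (f : ℝ[X]) (u : V), ∃ c : ℕ → ℝ,
      ∀ w, aeval (G.adjMatrix ℝ) f w u = c (G.dist u w)) (f : ℝ[X]) (u v : V) :
    aeval (G.adjMatrix ℝ) f u u = aeval (G.adjMatrix ℝ) f v v := by
  have step : ∀ a b, G.Adj a b → aeval (G.adjMatrix ℝ) (X * f.divX) a a =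
      k * aeval (G.adjMatrix ℝ) f.divX b a := by
    intro a b hab
    obtain ⟨c, hc⟩ := hcol f.divX a
    rw [map_mul, aeval_X, SimpleGraph.adjMatrix_mul_apply]
    have : ∀ w ∈ G.neighborFinset a, aeval (G.adjMatrix ℝ) f.divX w a =
        aeval (G.adjMatrix ℝ) f.divX b a := by
      intro w hw
      rw [hc, hc, SimpleGraph.dist_eq_one_iff_adj.2 hab,
        SimpleGraph.dist_eq_one_iff_adj.2 ((G.mem_neighborFinset a w).1 hw)]
    rw [Finset.sum_congr rfl this, Finset.sum_const, SimpleGraph.card_neighborFinset_eq_degree,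
      hreg, nsmul_eq_mul]
  have adj : ∀ a b, G.Adj a b →
      aeval (G.adjMatrix ℝ) f a a = aeval (G.adjMatrix ℝ) f b b := by
    intro a b hab
    rw [← Polynomial.X_mul_divX_add f, map_add, aeval_C, Matrix.add_apply, Matrix.add_apply,
      step a b hab, step b a hab.symm, (G.isSymm_adjMatrix.aeval f.divX).apply]
    simp [Matrix.algebraMap_matrix_apply]
  obtain ⟨p⟩ := hconn.preconnected u v
  induction p with
  | nil => rfl
  | cons h _ ih => exact (adj _ _ h).trans ih

theorem IsDistancePolynomials.exists_aeval_eq {V : Type*} [Fintype V] [DecidableEq V]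
    {G : SimpleGraph V} {A : Matrix V V ℝ} {u : V} {e : ℕ} {q : ℕ → ℝ[X]} (he : IsEcc G u e)
    (hq : IsDistancePolynomials G A u e q) {M : ℝ[X]} (hM : M.Monic)
    (hdeg : M.degree = ((e + 1 : ℕ) : WithBot ℕ)) (hann : ∀ w, aeval A M w u = 0) (f : ℝ[X]) :
    ∃ c : ℕ → ℝ, ∀ w, aeval A f w u = c (G.dist u w) := by
  obtain ⟨c, -, hc⟩ := hq.exists_expansion le_rfl (hdeg ▸ Polynomial.degree_modByMonic_lt f hM)
  refine ⟨c, fun w => ?_⟩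
  have h := hc w
  rw [if_pos (Nat.lt_succ_of_le (he.1 w))] at h
  conv_lhs => rw [← Polynomial.modByMonic_add_div f M, mul_comm M, map_add, map_mul,
    Matrix.add_apply, Matrix.mul_apply, h]
  simp [hann]

theorem IsDistancePolynomials.ecc_le {V : Type*} [Fintype V] [DecidableEq V]
    {G : SimpleGraph V} {A : Matrix V V ℝ} {u : V} {e : ℕ} {q : ℕ → ℝ[X]}
    (hconn : G.Connected) (he : IsEcc G u e) (hq : IsDistancePolynomials G A u e q) {M : ℝ[X]}
    (hM : M ≠ 0) {d : ℕ} (hdeg : M.degree = ((d + 1 : ℕ) : WithBot ℕ))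
    (hann : ∀ w, aeval A M w u = 0) : e ≤ d := by
  by_contra! hlt
  obtain ⟨c, hMc, hc⟩ := hq.exists_expansion le_rfl
    (hdeg.trans_lt (Nat.cast_lt.2 (show d + 1 < e + 1 by omega)))
  apply hM
  rw [hMc]
  refine Finset.sum_eq_zero fun i hi => ?_
  have hi := Finset.mem_range.1 hi
  obtain ⟨v, hv⟩ := he.2
  obtain ⟨w, rfl⟩ := hconn.exists_dist_eq (u := u) (v := v) (i := i) (by omega)
  have h := hc w
  rw [hann, if_pos hi] at h
  rw [← h, C_0, zero_mul]

theorem IsDistancePolynomials.apply_eq_apply {V : Type*} [Fintype V] [DecidableEq V]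
    {G : SimpleGraph V} [DecidableRel G.Adj] {k : ℕ} (hreg : ∀ v, G.degree v = k)
    (hconn : G.Connected) {u v : V} {e : ℕ} (heu : IsEcc G u e) (hev : IsEcc G v e)
    {q r : ℕ → ℝ[X]} (hq : IsDistancePolynomials G (G.adjMatrix ℝ) u e q)
    (hr : IsDistancePolynomials G (G.adjMatrix ℝ) v e r)
    (hdiag : ∀ f : ℝ[X], aeval (G.adjMatrix ℝ) f u u = aeval (G.adjMatrix ℝ) f v v)
    {i : ℕ} (hi : i ≤ e) : q i = r i := by
  have hsymm : (G.adjMatrix ℝ).IsSymm := G.isSymm_adjMatrix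
  have hpos : ∀ {x : V}, IsEcc G x e → ∀ j ≤ e,
      (∑ w, if G.dist x w = j then (1 : ℝ) else 0) ≠ 0 := by
    intro x hx j hj
    obtain ⟨y, hy⟩ := hx.2
    obtain ⟨w, hw⟩ := hconn.exists_dist_eq (hj.trans_eq hy.symm)
    refine (Finset.sum_pos' (fun z _ => by split_ifs <;> norm_num)
      ⟨w, Finset.mem_univ w, by simp [hw]⟩).ne'
  obtain ⟨c, hqc, hc⟩ := hr.exists_expansion (f := q i) (n := i + 1) (by omega)
    (by rw [(hq i hi).1]; exact Nat.cast_lt.2 (Nat.lt_succ_self i))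
  have hpair : ∀ j < i + 1, aeval (G.adjMatrix ℝ) (q i * r j) v v =
      c j * ∑ w, if G.dist v w = j then (1 : ℝ) else 0 := by
    intro j hj
    rw [aeval_mul_apply hsymm, Finset.mul_sum]
    refine Finset.sum_congr rfl fun w _ => ?_
    rw [(hr j (by omega)).2, hc]
    split_ifs with h1 h2 <;> first | omega | simp_all
  have hzero : ∀ j < i, c j = 0 := by
    intro j hj
    have h := hpair j (by omega)
    rw [← hdiag, aeval_mul_apply hsymm, Finset.sum_eq_zero] at h
    · exact (mul_eq_zero.1 h.symm).resolve_right (hpos hev j (by omega))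
    · intro w _
      obtain ⟨b, -, hb⟩ := hq.exists_expansion (f := r j) (n := i) (by omega)
        (by rw [(hr j (by omega)).1]; exact Nat.cast_lt.2 hj)
      rw [(hq i hi).2, hb]
      split_ifs <;> first | omega | simp
  have hqr : q i = C (c i) * r i := by
    rw [hqc, Finset.sum_range_succ, Finset.sum_eq_zero, zero_add]
    intro j hj
    rw [hzero j (Finset.mem_range.1 hj), C_0, zero_mul]
  have hcount_q := sum_aeval_adjMatrix hreg (q i) u
  have hcount_r := sum_aeval_adjMatrix hreg (r i) v
  have hnorm := aeval_mul_apply hsymm (q i) (q i) u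
  have hpi := hpair i (Nat.lt_succ_self i)
  have hsq : aeval (G.adjMatrix ℝ) (q i * q i) v v =
      c i * aeval (G.adjMatrix ℝ) (q i * r i) v v := by
    conv_lhs => rw [hqr, mul_assoc, ← hqr, mul_comm (r i), ← Polynomial.smul_eq_C_mul, map_smul]
    simp
  simp only [(hq i hi).2, (hr i hi).2, ite_mul, one_mul, zero_mul] at hcount_q hcount_r hnorm
  have hnorm' : aeval (G.adjMatrix ℝ) (q i * q i) u u =
      ∑ w, if G.dist u w = i then (1 : ℝ) else 0 := by
    rw [hnorm]
    exact Finset.sum_congr rfl fun w _ => by split_ifs <;> rfl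
  have heval : (q i).eval (k : ℝ) = c i * (r i).eval (k : ℝ) := by
    conv_lhs => rw [hqr]
    simp
  have hone : c i = 1 := by
    rw [← hcount_q, ← hcount_r, ← hnorm', hdiag, hsq, hpi] at heval
    have hr0 := hpos hev i hi
    have hci : c i ≠ 0 := by
      intro h0
      have := hpos heu i hi
      rw [← hnorm', hdiag, hsq, h0, zero_mul] at this
      exact this rfl
    exact mul_right_cancel₀ hr0 ((mul_left_cancel₀ hci heval).trans (one_mul _).symm)
  rw [hqr, hone, C_1, one_mul]

theorem eSupport_subset_spectrum {V : Type*} [Fintype V] [DecidableEq V] (A : Matrix V V ℝ)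
    (u : V) : eSupport A u ⊆ spectrum ℝ A := by
  rintro θ ⟨w, hw, hwu⟩
  rw [← Matrix.spectrum_toLin', ← Module.End.hasEigenvalue_iff_mem_spectrum]
  refine Module.End.hasEigenvalue_of_hasEigenvector
    (x := w) ⟨Module.End.mem_eigenspace_iff.2 (by simpa using hw), ?_⟩
  rintro rfl
  exact hwu rfl

theorem eval_eq_zero_of_mem_spectrum {V : Type*} [Fintype V] [DecidableEq V] [Nonempty V]
    {A : Matrix V V ℝ} {f : ℝ[X]} (hf : aeval A f = 0) {θ : ℝ} (hθ : θ ∈ spectrum ℝ A) :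
    f.eval θ = 0 := by
  have h := spectrum.subset_polynomial_aeval A f ⟨θ, hθ, rfl⟩
  rw [hf, spectrum.zero_eq] at h
  exact h

/-- A connected regular graph that is pseudo-distance-regular at every vertex is
distance-regular. -/
theorem regular_pseudo_distance_regular_everywhere
    {V : Type*} [Fintype V] [DecidableEq V] (G : SimpleGraph V) [DecidableRel G.Adj]
    (hconn : G.Connected) (k : ℕ) (hreg : ∀ v, G.degree v = k)
    (hpdr : ∀ (u : V) (e : ℕ), IsEcc G u e → IsPseudoDistRegular G (G.adjMatrix ℝ) u e) :
    ∃ d : ℕ, IsDiam G d ∧ IsDistRegular G (G.adjMatrix ℝ) d := by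
  have : Nonempty V := hconn.nonempty
  have hsymm : (G.adjMatrix ℝ).IsSymm := G.isSymm_adjMatrix
  choose e he using fun u => exists_isEcc (G := G) u
  have hp := fun u => hpdr u (e u) (he u)
  choose q hq using fun u => exists_isDistancePolynomials hconn hreg (he u) (hp u)
  choose M hM _ hdeg hroot hann using
    fun u => exists_monic_annihilator (G.isHermitian_adjMatrix ℝ) (hp u).1
  have hdiag := aeval_adjMatrix_apply_self_eq hconn hreg fun f u =>
    (hq u).exists_aeval_eq (he u) (hM u) (hdeg u) (hann u) f
  have hzero : ∀ u v w, aeval (G.adjMatrix ℝ) (M u) w v = 0 := by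
    intro u v w
    have h : aeval (G.adjMatrix ℝ) (M u * M u) v v = 0 := by
      rw [hdiag _ v u, aeval_mul_apply hsymm]
      simp [hann]
    rw [aeval_mul_apply hsymm, Finset.sum_eq_zero_iff_of_nonneg fun w _ => mul_self_nonneg _] at h
    exact mul_self_eq_zero.1 (h w (Finset.mem_univ w))
  obtain ⟨u⟩ := this
  have hecc : ∀ v, e v = e u := fun v => le_antisymm
    ((hq v).ecc_le hconn (he v) (hM u).ne_zero (hdeg u) (hzero u v))
    ((hq u).ecc_le hconn (he u) (hM v).ne_zero (hdeg v) (hzero v u))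
  refine ⟨e u, ⟨fun v w => hecc v ▸ (he v).1 w, u, (he u).2⟩, ?_, fun i hi =>
    ⟨q u i, (hq u i hi).1, ?_⟩⟩
  · have : Nonempty V := ⟨u⟩
    rw [← (hp u).1]
    congr 1
    refine Set.Subset.antisymm (fun θ hθ => (hroot u θ).1 ?_) (eSupport_subset_spectrum _ u)
    refine eval_eq_zero_of_mem_spectrum ?_ hθ
    ext w v
    exact hzero u v w
  · ext w v
    have heq := (hq u).apply_eq_apply hreg hconn (he u) (hecc v ▸ he v) (hecc v ▸ hq v)
      (fun f => hdiag f u v) hi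
    rw [heq, (hq v i (hecc v ▸ hi)).2, distMatrix, Matrix.of_apply, G.dist_comm]
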